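/- Let H be a real Hilbert space and T : H → H nonexpansive with Fix(T) ≠ ∅. Let (z^k), (μ^k) be generated by the inexact inertial Krasnoselskii–Mann iteration and assume conditions (II) hold. Then for every z* ∈ Fix(T), the limit lim_{k→∞} ‖z^k − z*‖ exists. -/

import Mathlib

open Filter Topology

/-- A real sequence that is bounded below and whose increments have summable upper bounds
converges. -/
lemma exists_tendsto_of_increment_le {u η : ℕ → ℝ} {c : ℝ} (hc : ∀ k, c ≤ u k)
    (hη : Summable η) (hu : ∀ k, u (k + 1) ≤ u k + η k) :
    ∃ L : ℝ, Tendsto u atTop (𝓝 L) := by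
  have hS := hη.hasSum.tendsto_sum_nat
  obtain ⟨B, hB⟩ := hS.bddAbove_range
  have hanti : Antitone fun k => u k - ∑ i ∈ Finset.range k, η i := by
    refine antitone_nat_of_succ_le fun k => ?_
    rw [Finset.sum_range_succ]
    linarith [hu k]
  have hbdd : BddBelow (Set.range fun k => u k - ∑ i ∈ Finset.range k, η i) := by
    refine ⟨c - B, ?_⟩
    rintro _ ⟨k, rfl⟩
    have := hB ⟨k, rfl⟩
    dsimp only at this ⊢
    linarith [hc k]
  exact ⟨_, by simpa using (tendsto_atTop_ciInf hanti hbdd).add hS⟩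

/-- A nonnegative sequence `d` is summable if, up to summable errors, some potential that is bounded
below decreases by at least `σ * d k` at step `k`. -/
lemma summable_of_potential_decrease {u d ε : ℕ → ℝ} {c σ : ℝ} (hσ : 0 < σ)
    (hc : ∀ k, c ≤ u k) (hd : ∀ k, 0 ≤ d k) (hε0 : ∀ k, 0 ≤ ε k) (hε : Summable ε)
    (hu : ∀ k, u (k + 1) + σ * d k ≤ u k + ε k) : Summable d := by
  refine summable_of_sum_range_le (c := (u 0 - c + ∑' i, ε i) / σ) hd fun n => ?_
  have h : u n + σ * ∑ i ∈ Finset.range n, d i ≤ u 0 + ∑ i ∈ Finset.range n, ε i := by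
    induction n with
    | zero => simp
    | succ n ih =>
      rw [Finset.sum_range_succ, Finset.sum_range_succ]
      linarith [hu n]
  rw [le_div_iff₀ hσ]
  linarith [hc n, hε.sum_le_tsum (Finset.range n) fun i _ => hε0 i]

/-- A nonnegative sequence that contracts up to summable perturbations is summable. -/
lemma summable_of_le_mul_add {u η : ℕ → ℝ} {a : ℝ} (ha : a < 1) (hu0 : ∀ k, 0 ≤ u k)
    (hη0 : ∀ k, 0 ≤ η k) (hη : Summable η) (hu : ∀ k, u (k + 1) ≤ a * u k + η k) :
    Summable u :=
  summable_of_potential_decrease (sub_pos.2 ha) hu0 hu0 hη0 hη fun k => by linarith [hu k]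

/-- Convergence of a bounded nonnegative sequence satisfying the inertial descent inequality. -/
lemma exists_tendsto_of_inertial_descent {φ d ε α : ℕ → ℝ} {a γ σ B : ℝ}
    (hφ0 : ∀ k, 0 ≤ φ k) (hφB : ∀ k, φ k ≤ B) (hd : ∀ k, 0 ≤ d k) (hε0 : ∀ k, 0 ≤ ε k)
    (hε : Summable ε) (hαmono : Monotone α) (hα : ∀ k, 0 ≤ α k ∧ α k ≤ a) (ha : a < 1)
    (hγ : 0 ≤ γ) (hσ : 0 < σ)
    (h : ∀ k, φ (k + 2) - φ (k + 1) - α k * (φ (k + 1) - φ k) ≤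
      -(γ + σ) * d (k + 1) + γ * d k + ε k) :
    ∃ L : ℝ, Tendsto φ atTop (𝓝 L) := by
  have hdsum : Summable d := by
    refine (summable_nat_add_iff 1).1 ?_
    refine summable_of_potential_decrease (u := fun k => φ (k + 1) - α k * φ k + γ * d k)
      (c := -B) hσ (fun k => ?_) (fun k => hd _) hε0 hε fun k => ?_
    · have h1 : α k * φ k ≤ 1 * B :=
        mul_le_mul ((hα k).2.trans ha.le) (hφB k) (hφ0 k) zero_le_one
      linarith [hφ0 (k + 1), mul_nonneg hγ (hd k)]
    · have h1 := mul_le_mul_of_nonneg_right (hαmono k.le_succ) (hφ0 (k + 1))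
      simp only [Nat.succ_eq_add_one] at h1
      linarith [h k]
  have hη : Summable fun k => γ * d k + ε k := (hdsum.mul_left γ).add hε
  have hη0 : ∀ k, 0 ≤ γ * d k + ε k := fun k => add_nonneg (mul_nonneg hγ (hd k)) (hε0 k)
  have hpos : Summable fun k => max (φ (k + 1) - φ k) 0 := by
    refine summable_of_le_mul_add ha (fun k => le_max_right _ _) hη0 hη fun k => ?_
    have ha0 : 0 ≤ a := (hα k).1.trans (hα k).2
    have hm0 : 0 ≤ max (φ (k + 1) - φ k) 0 := le_max_right _ _
    refine max_le ?_ (add_nonneg (mul_nonneg ha0 hm0) (hη0 k))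
    have h1 := mul_le_mul_of_nonneg_left (le_max_left (φ (k + 1) - φ k) 0) (hα k).1
    have h2 := mul_le_mul_of_nonneg_right (hα k).2 hm0
    have h3 := mul_nonneg (add_nonneg hγ hσ.le) (hd (k + 1))
    linarith [h k]
  exact exists_tendsto_of_increment_le hφ0 hpos fun k => by
    linarith [le_max_left (φ (k + 1) - φ k) 0]

section InnerProduct

variable {H : Type*} [NormedAddCommGroup H] [InnerProductSpace ℝ H]

lemma norm_add_smul_sub_sq (u v : H) (t : ℝ) :
    ‖u + t • (v - u)‖ ^ 2 = (1 - t) * ‖u‖ ^ 2 + t * ‖v‖ ^ 2 - t * (1 - t) * ‖v - u‖ ^ 2 := by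
  simp only [norm_add_sq_real, norm_sub_sq_real, norm_smul, inner_smul_right, inner_sub_right,
    real_inner_self_eq_norm_sq, mul_pow, Real.norm_eq_abs, sq_abs, real_inner_comm]
  ring

lemma sq_norm_sub_two_mul_le_sq_norm_sub (u v : H) :
    ‖u‖ ^ 2 - 2 * (‖u‖ * ‖v‖) ≤ ‖u - v‖ ^ 2 := by
  rw [norm_sub_sq_real]
  linarith [real_inner_le_norm u v, sq_nonneg ‖v‖]

/-- Lower bound for an inertial displacement, by a weighted Young inequality. -/
lemma le_norm_sub_smul_sq (u v : H) {t s : ℝ} (ht : 0 ≤ t) (hs : 0 < s) :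
    (1 - t / s) * ‖u‖ ^ 2 + (t ^ 2 - t * s) * ‖v‖ ^ 2 ≤ ‖u - t • v‖ ^ 2 := by
  have h := norm_sub_sq_real u (t • v)
  rw [norm_smul, inner_smul_right, mul_pow, Real.norm_eq_abs, sq_abs] at h
  have h1 : 2 * inner ℝ u v ≤ ‖u‖ ^ 2 / s + s * ‖v‖ ^ 2 := by
    have h2 : ‖u‖ ^ 2 / s + s * ‖v‖ ^ 2 - 2 * (‖u‖ * ‖v‖) = (‖u‖ - s * ‖v‖) ^ 2 / s := by
      field_simp
      ring
    have h3 : 0 ≤ (‖u‖ - s * ‖v‖) ^ 2 / s := by positivity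
    linarith [real_inner_le_norm u v]
  have h4 := mul_le_mul_of_nonneg_left h1 ht
  rw [h]
  have h5 : t / s * ‖u‖ ^ 2 = t * (‖u‖ ^ 2 / s) := by ring
  linarith

/-- One step of the inexact inertial Krasnoselskii–Mann iteration: from the consecutive
iterates `x, y` to `w`, through the extrapolated point `m`. -/
lemma inertial_krasnoselskii_mann_step {T : H → H} (hT : ∀ x y : H, ‖T x - T y‖ ≤ ‖x - y‖)
    {p x y w m e : H} (hp : T p = p) {α lam a γ σ δ R S : ℝ}
    (hm : m = y + α • (y - x)) (hw : w = m + lam • (T m + e - m))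
    (hα : 0 ≤ α) (hαa : α ≤ a) (hlam : 0 < lam) (hlam1 : lam ≤ 1) (hδ : 0 < δ)
    (hγ : a * (1 + a) + a * δ = γ) (hσ : 0 < σ)
    (hbound : lam * (δ * (1 + γ + σ)) ≤ δ - a * (γ + σ))
    (hR : ‖w - p‖ ≤ R) (hS : ‖w - m‖ ≤ S) :
    ‖w - p‖ ^ 2 - ‖y - p‖ ^ 2 - α * (‖y - p‖ ^ 2 - ‖x - p‖ ^ 2) ≤
      -(γ + σ) * ‖w - y‖ ^ 2 + γ * ‖y - x‖ ^ 2 + 2 * (R + S) * ‖e‖ := by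
  have ha : 0 ≤ a := hα.trans hαa
  have hγ0 : 0 ≤ γ := hγ ▸ by positivity
  set s := α + δ * lam with hs_def
  have hs : 0 < s := by positivity
  have hrelax : ‖w - p - lam • e‖ ^ 2 ≤ ‖m - p‖ ^ 2 - lam * (1 - lam) * ‖T m - m‖ ^ 2 := by
    have h1 : w - p - lam • e = (m - p) + lam • ((T m - p) - (m - p)) := by
      rw [hw]; module
    rw [h1, norm_add_smul_sub_sq, sub_sub_sub_cancel_right]
    have h2 : ‖T m - p‖ ^ 2 ≤ ‖m - p‖ ^ 2 := by
      have h3 := hT m p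
      rw [hp] at h3
      gcongr
    linarith [mul_le_mul_of_nonneg_left h2 hlam.le]
  have hinertia : ‖m - p‖ ^ 2 =
      (1 + α) * ‖y - p‖ ^ 2 - α * ‖x - p‖ ^ 2 + α * (1 + α) * ‖y - x‖ ^ 2 := by
    have h1 : m - p = (y - p) + (-α) • ((x - p) - (y - p)) := by rw [hm]; module
    rw [h1, norm_add_smul_sub_sq, sub_sub_sub_cancel_right, norm_sub_rev x y]
    ring
  have herror : ‖w - p‖ ^ 2 - 2 * (R * ‖e‖) ≤ ‖w - p - lam • e‖ ^ 2 := by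
    have h1 := sq_norm_sub_two_mul_le_sq_norm_sub (w - p) (lam • e)
    rw [norm_smul, Real.norm_of_nonneg hlam.le] at h1
    have h2 : ‖w - p‖ * (lam * ‖e‖) ≤ R * (1 * ‖e‖) := by
      have := (norm_nonneg _).trans hR
      gcongr
    linarith
  have hresidual : δ / s * ‖w - y‖ ^ 2 - α * δ * ‖y - x‖ ^ 2 - 2 * (S * ‖e‖) ≤
      lam * ‖T m - m‖ ^ 2 := by
    have h1 := sq_norm_sub_two_mul_le_sq_norm_sub (w - m) (lam • e)
    have h2 : w - m - lam • e = lam • (T m - m) := by rw [hw]; module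
    rw [h2, norm_smul, norm_smul, Real.norm_of_nonneg hlam.le, mul_pow] at h1
    have h3 := le_norm_sub_smul_sq (w - y) (y - x) hα hs
    have h4 : w - y - α • (y - x) = w - m := by rw [hm]; module
    rw [h4] at h3
    have h5 : 1 - α / s = lam * (δ / s) := by
      rw [hs_def] at hs ⊢
      field_simp
      ring
    rw [h5] at h3
    have h6 : ‖w - m‖ * (lam * ‖e‖) ≤ S * (lam * ‖e‖) := by gcongr
    refine le_of_mul_le_mul_left ?_ hlam
    have h7 : α ^ 2 - α * s = -(lam * (α * δ)) := by rw [hs_def]; ring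
    rw [h7] at h3
    linarith
  have hcoef : γ + σ ≤ (1 - lam) * (δ / s) := by
    rw [← mul_div_assoc, le_div_iff₀ hs, hs_def]
    linarith [mul_le_mul_of_nonneg_right hαa (add_nonneg hγ0 hσ.le)]
  have hS0 : 0 ≤ S := (norm_nonneg _).trans hS
  have k1 := mul_le_mul_of_nonneg_left hresidual (sub_nonneg.2 hlam1)
  have k2 := mul_le_mul_of_nonneg_right hcoef (sq_nonneg ‖w - y‖)
  have k3 : (α * (1 + α) + (1 - lam) * (α * δ)) * ‖y - x‖ ^ 2 ≤ γ * ‖y - x‖ ^ 2 := by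
    refine mul_le_mul_of_nonneg_right ?_ (sq_nonneg _)
    have h1 : α * (1 + α) ≤ a * (1 + a) := by gcongr
    have h2 : α * δ ≤ a * δ := by gcongr
    have h3 : 0 ≤ lam * (α * δ) := by positivity
    linarith
  have k4 : 0 ≤ lam * (S * ‖e‖) := by positivity
  linarith

end InnerProduct

/-- Theorem 3.2 (ii): under conditions (II), for every fixed point z* of T, lim ‖z^k − z*‖ exists. -/
theorem inexact_inertial_KM_condII_norm_limit_exists
    {H : Type*} [NormedAddCommGroup H] [InnerProductSpace ℝ H] [CompleteSpace H]
    (T : H → H) (hT : ∀ x y : H, ‖T x - T y‖ ≤ ‖x - y‖)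
    (hfix : ∃ p : H, T p = p)
    (z μ e : ℕ → H) (α lam : ℕ → ℝ) (a l σ δ : ℝ)
    -- the iteration: `z (k+1)` stands for `z^k` (so `z 0` is `z^{-1}`), `μ k` for `μ^k`
    (hμ : ∀ k, μ k = z (k + 1) + α k • (z (k + 1) - z k))
    (hz : ∀ k, z (k + 2) = μ k + lam k • (T (μ k) + e k - μ k))
    -- conditions (II)
    (hαmono : Monotone α) (hα0 : α 0 = 0)
    (hα : ∀ k, 0 ≤ α k ∧ α k ≤ a) (ha1 : a < 1)
    (hl : 0 < l) (hσ : 0 < σ) (hδ : 0 < δ)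
    (hδbig : δ > a * (a * (1 + a) + σ) / (1 - a ^ 2))
    (hlam : ∀ k, l ≤ lam k ∧
      lam k ≤ (δ - a * (a * (1 + a) + a * δ + σ)) / (δ * (1 + a * (1 + a) + a * δ + σ)))
    (hbdd : ∃ M : ℝ, ∀ k, ‖z k‖ ≤ M)
    (hsume : Summable fun k => ‖e k‖) :
    ∀ zs : H, T zs = zs →
      ∃ L : ℝ, Tendsto (fun k => ‖z k - zs‖) atTop (nhds L) := by
  intro p hp
  obtain ⟨M, hM⟩ := hbdd
  have ha0 : 0 ≤ a := (hα 0).1.trans (hα 0).2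
  have hM0 : 0 ≤ M := (norm_nonneg _).trans (hM 0)
  have hdiff : ∀ i j, ‖z i - z j‖ ≤ M + M := fun i j => norm_sub_le_of_le (hM i) (hM j)
  have hp_bound : ∀ k, ‖z k - p‖ ≤ M + ‖p‖ := fun k => norm_sub_le_of_le (hM k) le_rfl
  have hC : 0 ≤ 2 * (M + ‖p‖ + (M + M + (M + M))) := by positivity
  have hden : 0 < δ * (1 + a * (1 + a) + a * δ + σ) := by positivity
  have hlam0 : ∀ k, 0 < lam k := fun k => hl.trans_le (hlam k).1
  have hbound : ∀ k, lam k * (δ * (1 + (a * (1 + a) + a * δ) + σ)) ≤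
      δ - a * (a * (1 + a) + a * δ + σ) := fun k => by
    have h := (le_div_iff₀ hden).1 (hlam k).2
    rwa [← add_assoc 1]
  have hlam1 : ∀ k, lam k ≤ 1 := fun k => by
    refine (hlam k).2.trans ((div_le_one hden).2 ?_)
    have h1 : 0 ≤ a * (a * (1 + a) + a * δ + σ) := by positivity
    have h2 : 0 ≤ δ * (a * (1 + a) + a * δ + σ) := by positivity
    linarith
  have hstep : ∀ k, ‖z (k + 2) - μ k‖ ≤ M + M + (M + M) := fun k => by
    have h1 : z (k + 2) - μ k = (z (k + 2) - z (k + 1)) - α k • (z (k + 1) - z k) := by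
      rw [hμ]; module
    rw [h1]
    refine norm_sub_le_of_le (hdiff _ _) ?_
    rw [norm_smul, Real.norm_of_nonneg (hα k).1]
    exact (mul_le_of_le_one_left (norm_nonneg _) ((hα k).2.trans ha1.le)).trans (hdiff _ _)
  obtain ⟨L, hL⟩ := exists_tendsto_of_inertial_descent (φ := fun k => ‖z k - p‖ ^ 2)
    (d := fun k => ‖z (k + 1) - z k‖ ^ 2)
    (fun k => sq_nonneg _) (fun k => pow_le_pow_left₀ (norm_nonneg _) (hp_bound k) 2)
    (fun k => sq_nonneg _) (fun k => mul_nonneg hC (norm_nonneg (e k)))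
    (hsume.mul_left _) hαmono hα ha1 (by positivity) hσ
    fun k => inertial_krasnoselskii_mann_step hT hp (hμ k) (hz k) (hα k).1 (hα k).2 (hlam0 k)
      (hlam1 k) hδ rfl hσ (hbound k) (hp_bound _) (hstep k)
  exact ⟨√L, by simpa using hL.sqrt⟩
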